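/- For every ε > 0 there exist sets S, A ⊆ ℤ such that S is dense in the Bohr topology of ℤ, the upper Banach density of A satisfies d*(A) > 1/2 − ε, and (A − A) ∩ S = ∅. -/

import Mathlib

open MeasureTheory Filter Pointwise

/-- Upper Banach density of a set of integers:
`d*(A) = limsup_{n→∞} sup_{k∈ℤ} |A ∩ {k+1,…,k+n}| / n`. -/
noncomputable def upperBanachDensity (A : Set ℤ) : ℝ :=
  Filter.atTop.limsup fun n : ℕ =>
    ⨆ k : ℤ, (Nat.card ↥(A ∩ Set.Ioc k (k + n)) : ℝ) / n

/-- The Bohr topology on ℤ: the weakest topology making every group homomorphism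
from ℤ to 𝕋 = ℝ/ℤ continuous. -/
noncomputable def bohrTopology : TopologicalSpace ℤ :=
  ⨅ φ : ℤ →+ AddCircle (1 : ℝ), TopologicalSpace.induced (⇑φ) inferInstance

/-- A set of integers is Bohr dense if it is dense in the Bohr topology of ℤ. -/
def BohrDense (S : Set ℤ) : Prop := @Dense ℤ bohrTopology S


lemma algA_card {ι : Type*} [Fintype ι] {d q M : ℕ} (hM : 0 < M) [NeZero q]
    (H : Submodule ℤ (Fin d → ZMod q)) :
    Nat.card (H ⧸ (LinearMap.range (LinearMap.lsmul ℤ H (M : ℤ)))) ≤ M ^ d := by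
  classical
  set L := LinearMap.lsmul ℤ H (M : ℤ) with hL
  have h1 : Nat.card H = Nat.card (LinearMap.range L) * Nat.card (H ⧸ LinearMap.range L) := 
    Submodule.card_eq_card_quotient_mul_card _ |>.trans (by ring)
  have h2 : Nat.card H = Nat.card (LinearMap.ker L) * Nat.card (H ⧸ LinearMap.ker L) := 
    Submodule.card_eq_card_quotient_mul_card _ |>.trans (by ring)
  have h3 : Nat.card (H ⧸ LinearMap.ker L) = Nat.card (LinearMap.range L) :=
    Nat.card_congr (LinearMap.quotKerEquivRange L).toEquiv
  have h4 : 0 < Nat.card (LinearMap.range L) := Nat.card_pos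
  have h5 : Nat.card (H ⧸ LinearMap.range L) = Nat.card (LinearMap.ker L) := by
    rw [h3] at h2
    have : Nat.card (LinearMap.range L) * Nat.card (H ⧸ LinearMap.range L) = 
      Nat.card (LinearMap.range L) * Nat.card (LinearMap.ker L) := by rw [← h1, h2]; ring
    exact Nat.eq_of_mul_eq_mul_left h4 this
  rw [h5]
  let Z := {x : ZMod q // M • x = 0}
  have hZ : Fintype.card Z ≤ M := by
    have := IsAddCyclic.card_nsmul_eq_zero_le (α := ZMod q) hM
    rw [Fintype.card_subtype]
    exact this
  let F : LinearMap.ker L → (Fin d → Z) := fun x i => ⟨(x : H).1 i, by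
    have := x.2
    rw [LinearMap.mem_ker] at this
    have h : ((M : ℤ) • (x : H).1) i = 0 := congrArg (fun y : H => y.1 i) this
    rw [Pi.smul_apply, natCast_zsmul] at h
    exact h⟩
  have hF : Function.Injective F := by
    intro x y h
    ext i
    have := congrFun h i
    exact congrArg Subtype.val this
  calc Nat.card (LinearMap.ker L) ≤ Nat.card (Fin d → Z) := Nat.card_le_card_of_injective F hF
    _ = (Fintype.card Z) ^ d := by simp
    _ ≤ M ^ d := Nat.pow_le_pow_left hZ d

lemma algA {ι : Type*} [Fintype ι] [DecidableEq ι] {d q M : ℕ} (hM : 0 < M) (hq : 0 < q)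
    (θ : ι → (Fin d → ZMod q)) :
    ∃ c : ι → ℕ, (∀ i, c i < q * M) ∧
      (Finset.univ.filter (fun i => ¬ c i % M = 1 % M)).card ≤ M ^ d ∧
      ∑ i, c i • θ i = 0 := by
  classical
  have : NeZero q := ⟨hq.ne'⟩
  set H := Submodule.span ℤ (Set.range θ) with hH
  set L := LinearMap.lsmul ℤ H (M : ℤ) with hL
  have hcard := algA_card (ι := ι) hM H
  rw [← hL] at hcard
  have hmem : ∀ i, θ i ∈ H := fun i => Submodule.subset_span ⟨i, rfl⟩
  let ψ : ι → H ⧸ LinearMap.range L := fun i => Submodule.Quotient.mk ⟨θ i, hmem i⟩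
  -- representatives
  have hr : ∀ y : Set.range ψ, ∃ i, ψ i = y := fun y => y.2
  choose rep hrep using hr
  let ρ : ι → ι := fun i => rep ⟨ψ i, i, rfl⟩
  have hρ : ∀ i, ψ (ρ i) = ψ i := fun i => hrep _
  have hI : (Finset.univ.image ρ).card ≤ M ^ d := by
    have hsub : Finset.univ.image ρ ⊆ Finset.univ.image rep := by
      intro x hx
      simp only [Finset.mem_image, Finset.mem_univ, true_and] at hx ⊢
      obtain ⟨i, rfl⟩ := hx
      exact ⟨_, rfl⟩
    refine (Finset.card_le_card hsub).trans (Finset.card_image_le.trans ?_)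
    rw [Finset.card_univ, ← Nat.card_eq_fintype_card]
    have : Finite (H ⧸ LinearMap.range L) := inferInstance
    exact (Nat.card_le_card_of_injective _ Subtype.val_injective).trans hcard
  have hdiff : (∑ i, ((⟨θ i, hmem i⟩ : H) - ⟨θ (ρ i), hmem _⟩)) ∈ LinearMap.range L := by
    refine Submodule.sum_mem _ fun i _ => ?_
    exact (Submodule.Quotient.eq _).1 (hρ i).symm
  obtain ⟨h, hh⟩ := hdiff
  obtain ⟨b, hb⟩ := (Submodule.mem_span_range_iff_exists_fun ℤ).1 h.2
  have hEq : (M : ℤ) • ∑ i, b i • θ i = ∑ i, (θ i - θ (ρ i)) := by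
    rw [hb]
    have := congrArg Subtype.val hh
    simpa [hL] using this
  let e : ι → ℤ := fun i => 1 - ((Finset.univ.filter (fun j => ρ j = i)).card : ℤ) - M * b i
  have he : ∑ i, e i • θ i = 0 := by
    have h1 : ∑ i, θ (ρ i) = ∑ i, ((Finset.univ.filter (fun j => ρ j = i)).card : ℤ) • θ i := by
      rw [← Finset.sum_fiberwise (s := Finset.univ) (g := ρ)]
      refine Finset.sum_congr rfl fun i _ => ?_
      rw [Finset.sum_congr rfl (g := fun _ => θ i)]
      · simp
      · intro x hx
        rw [(Finset.mem_filter.1 hx).2]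
    simp only [e, sub_smul, Finset.sum_sub_distrib, one_smul]
    rw [← h1]
    rw [Finset.smul_sum, Finset.sum_sub_distrib] at hEq
    simp only [mul_smul]
    rw [hEq]; abel
  have hqM : (0 : ℤ) < q * M := by positivity
  have hec : ∀ i, (((e i) % (q * M : ℤ)).toNat : ℤ) = e i % (q * M) := fun i =>
    Int.toNat_of_nonneg (Int.emod_nonneg _ hqM.ne')
  refine ⟨fun i => ((e i) % (q * M : ℤ)).toNat, fun i => ?_, ?_, ?_⟩
  · zify
    rw [hec]
    exact Int.emod_lt_of_pos _ hqM
  · refine le_trans (Finset.card_le_card ?_) hI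
    intro i hi
    simp only [Finset.mem_filter, Finset.mem_univ, true_and] at hi
    by_contra hni
    apply hi
    have hz : (Finset.univ.filter (fun j => ρ j = i)) = ∅ := by
      rw [Finset.filter_eq_empty_iff]
      intro j _ hj
      exact hni (Finset.mem_image.2 ⟨j, Finset.mem_univ _, hj⟩)
    zify
    rw [hec, Int.emod_emod_of_dvd _ (Dvd.intro_left _ rfl)]
    simp only [e, hz]
    simp [Int.sub_emod]
  · rw [← he]
    refine Finset.sum_congr rfl fun i _ => ?_
    rw [← natCast_zsmul, hec]
    have h0 : (q : ℤ) • θ i = 0 := by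
      ext l; simp
    conv_rhs => rw [← Int.emod_add_mul_ediv (e i) (q * M)]
    have h1 : ((q : ℤ) * M * (e i / (q * M))) • θ i = 0 := by
      rw [mul_assoc, mul_comm, mul_smul, h0, smul_zero]
    rw [add_smul, h1, add_zero]

lemma dirichletB {ι : Type*} [Fintype ι] {δ : ℝ} (hδ : 0 < δ) :
    ∃ Q : ℕ, ∀ θ : ι → ℝ, ∃ q : ℕ, 0 < q ∧ q ≤ Q ∧ ∃ p : ι → ℤ, ∀ i, |q * θ i - p i| ≤ δ := by
  classical
  obtain ⟨N, hN⟩ := exists_nat_gt (1 / δ)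
  have hNpos : 0 < N := by
    have : (0 : ℝ) < N := lt_trans (by positivity) hN
    exact_mod_cast this
  have hNr : (0 : ℝ) < N := by exact_mod_cast hNpos
  refine ⟨N ^ Fintype.card ι, fun θ => ?_⟩
  let F : ℕ → (ι → Fin N) := fun m i => ⟨⌊Int.fract (m * θ i) * N⌋₊, by
    rw [Nat.floor_lt (by positivity)]
    have := Int.fract_lt_one ((m : ℝ) * θ i)
    nlinarith⟩
  have hc : (Finset.univ : Finset (ι → Fin N)).card < (Finset.range (N ^ Fintype.card ι + 1)).card := by
    simp
  obtain ⟨a, ha, b, hb, hab, hF⟩ := Finset.exists_ne_map_eq_of_card_lt_of_maps_to hc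
    (f := F) (fun _ _ => Finset.mem_coe.2 (Finset.mem_univ _))
  have key : ∀ a b : ℕ, a < b → b ≤ N ^ Fintype.card ι → F a = F b → 
      ∃ q : ℕ, 0 < q ∧ q ≤ N ^ Fintype.card ι ∧ ∃ p : ι → ℤ, ∀ i, |q * θ i - p i| ≤ δ := by
    intro a b hab hb hF
    refine ⟨b - a, by omega, by omega, fun i => ⌊(b : ℝ) * θ i⌋ - ⌊(a : ℝ) * θ i⌋, fun i => ?_⟩
    have h := congrArg Fin.val (congrFun hF i)
    simp only [F] at h
    have h1 := Nat.floor_le (a := Int.fract ((a : ℝ) * θ i) * N) (by positivity)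
    have h2 := Nat.lt_floor_add_one (Int.fract ((a : ℝ) * θ i) * N)
    have h3 := Nat.floor_le (a := Int.fract ((b : ℝ) * θ i) * N) (by positivity)
    have h4 := Nat.lt_floor_add_one (Int.fract ((b : ℝ) * θ i) * N)
    rw [h] at h1 h2
    have e1 := Int.self_sub_floor ((a : ℝ) * θ i)
    have e2 := Int.self_sub_floor ((b : ℝ) * θ i)
    rw [Nat.cast_sub hab.le]
    push_cast
    have : ((b : ℝ) - a) * θ i - (⌊(b : ℝ) * θ i⌋ - ⌊(a : ℝ) * θ i⌋) = 
      Int.fract ((b : ℝ) * θ i) - Int.fract ((a : ℝ) * θ i) := by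
      rw [← e1, ← e2]; ring
    rw [this]
    have hd : 1 < δ * N := by
      rw [div_lt_iff₀ hδ] at hN; linarith
    rw [abs_le]
    constructor
    · by_contra hcon
      push Not at hcon
      nlinarith
    · by_contra hcon
      push Not at hcon
      nlinarith
  rw [Finset.mem_range] at ha hb
  rcases lt_or_gt_of_ne hab with h | h
  · exact key a b h (by omega) hF
  · exact key b a h (by omega) hF.symm

lemma bohrC (M d n : ℕ) (hM : 0 < M) {η : ℝ} (hη : 0 < η) :
    ∃ C : ℕ, ∀ t : ℕ → ℕ, ∀ β : Fin d → ℝ, ∃ c : ℕ → ℕ, (∀ i, c i ≤ C) ∧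
      ((Finset.range n).filter (fun i => ¬ c i % M = 1 % M)).card ≤ M ^ d ∧
      ∀ l, ∃ p : ℤ, |((∑ i ∈ Finset.range n, c i * t i : ℕ) : ℝ) * β l - p| ≤ η := by
  classical
  obtain ⟨Q, hQ⟩ := dirichletB (ι := Fin n × Fin d) (δ := η / (n * M + 1)) (by positivity)
  refine ⟨Q * M, fun t β => ?_⟩
  obtain ⟨q, hq0, hqQ, p, hp⟩ := hQ (fun x => t x.1 * β x.2)
  obtain ⟨c, hc1, hc2, hc3⟩ := algA (ι := Fin n) (d := d) hM hq0 (fun i l => ((p (i, l) : ℤ) : ZMod q))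
  refine ⟨fun i => if h : i < n then c ⟨i, h⟩ else 0, fun i => ?_, ?_, fun l => ?_⟩
  · dsimp only
    split_ifs with h
    · exact (hc1 _).le.trans (Nat.mul_le_mul_right _ hqQ)
    · exact Nat.zero_le _
  · refine le_trans (le_of_eq ?_) hc2
    symm
    refine Finset.card_bij (fun i _ => i.1) ?_ ?_ ?_
    · intro a ha
      simp only [Finset.mem_filter, Finset.mem_univ, true_and] at ha
      simp [ha]
    · intro a _ b _ h
      exact Fin.ext h
    · intro b hb
      simp only [Finset.mem_filter, Finset.mem_range] at hb
      refine ⟨⟨b, hb.1⟩, ?_, rfl⟩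
      have := hb.2
      rw [dif_pos hb.1] at this
      simpa using this
  · have h := congrFun hc3 l
    simp only [Finset.sum_apply, Pi.smul_apply, Pi.zero_apply] at h
    have h' : (((∑ i, (c i : ℤ) * p (i, l)) : ℤ) : ZMod q) = 0 := by
      rw [← h]; push_cast
      simp
    rw [ZMod.intCast_zmod_eq_zero_iff_dvd] at h'
    obtain ⟨r, hr⟩ := h'
    refine ⟨r, ?_⟩
    have hq : (0 : ℝ) < q := by exact_mod_cast hq0
    have hr' : (r : ℝ) = ∑ i, (c i : ℝ) * (p (i, l) / q) := by
      have : ((∑ i, (c i : ℤ) * p (i, l) : ℤ) : ℝ) = q * r := by rw [hr]; push_cast; ring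
      push_cast at this
      have h2 : ∑ i, (c i : ℝ) * (p (i, l) / q) = (∑ i, (c i : ℝ) * p (i, l)) / q := by
        rw [Finset.sum_div]; refine Finset.sum_congr rfl fun i _ => by ring
      rw [h2, this]; field_simp
    rw [Finset.sum_range]
    simp only [Fin.is_lt, dif_pos, Fin.eta]
    rw [hr']
    push_cast
    rw [Finset.sum_mul, ← Finset.sum_sub_distrib]
    refine (Finset.abs_sum_le_sum_abs _ _).trans ?_
    have hb : ∀ i ∈ (Finset.univ : Finset (Fin n)), 
        |(c i : ℝ) * t i * β l - c i * (p (i, l) / q)| ≤ M * (η / (n * M + 1)) := by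
      intro i _
      have e1 : (c i : ℝ) * t i * β l - c i * (p (i, l) / q) = 
        (c i / q) * (q * (t i * β l) - p (i, l)) := by field_simp
      rw [e1, abs_mul, abs_of_nonneg (by positivity)]
      refine mul_le_mul ?_ (hp (i, l)) (abs_nonneg _) (by positivity)
      rw [div_le_iff₀ hq]
      have := (hc1 i).le
      have h3 : (c i : ℝ) ≤ q * M := by exact_mod_cast this
      linarith
    refine (Finset.sum_le_sum hb).trans ?_
    simp only [Finset.sum_const, Finset.card_univ, Fintype.card_fin, nsmul_eq_mul]
    rw [← mul_assoc, mul_div_assoc', div_le_iff₀ (by positivity)]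
    nlinarith


lemma sum_range_mul_split {α : Type*} [AddCommMonoid α] (F : ℕ → α) (a b : ℕ) :
    ∑ x ∈ Finset.range (a * b), F x = ∑ y ∈ Finset.range b, ∑ r ∈ Finset.range a, F (r + a * y) := by
  induction b with
  | zero => simp
  | succ b ih =>
    rw [Nat.mul_succ, Finset.sum_range_add, ih, Finset.sum_range_succ]
    simp only [add_comm]

/-- simple walk counts -/
noncomputable def wlk : ℕ → ℤ → ℝ
  | 0, y => if y = 0 then 1 else 0
  | j + 1, y => wlk j (y - 1) + wlk j (y + 1)

lemma wlk_eq (j : ℕ) : (∀ i : ℕ, wlk j (2 * i - j) = (j.choose i : ℝ)) ∧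
    (∀ y : ℤ, (∀ i : ℕ, y ≠ 2 * i - j) → wlk j y = 0) := by
  induction j with
  | zero =>
    constructor
    · intro i
      rcases i with _ | i
      · simp [wlk]
      · simp only [wlk, Nat.choose_zero_succ]
        rw [if_neg]; · simp
        push_cast; omega
    · intro y hy
      have := hy 0
      simp only [wlk]
      rw [if_neg]
      simpa using this
  | succ j ih =>
    obtain ⟨h1, h2⟩ := ih
    constructor
    · intro i
      simp only [wlk]
      have e2 : (2 * (i : ℤ) - ((j + 1 : ℕ) : ℤ) + 1) = 2 * i - j := by push_cast; ring
      rw [e2, h1 i]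
      rcases i with _ | i
      · rw [h2]
        · simp
        · intro i; push_cast; omega
      · have e1 : (2 * ((i + 1 : ℕ) : ℤ) - ((j + 1 : ℕ) : ℤ) - 1) = 2 * i - j := by push_cast; ring
        rw [e1, h1 i, Nat.choose_succ_succ]
        push_cast; ring
    · intro y hy
      simp only [wlk]
      rw [h2, h2]
      · simp
      · intro i h
        exact hy i (by push_cast; omega)
      · intro i h
        exact hy (i + 1) (by push_cast; omega)

lemma central_bound (m : ℕ) : (Nat.centralBinom m) ^ 2 * (2 * m + 1) ≤ 16 ^ m := by
  induction m with
  | zero => simp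
  | succ m ih =>
    have h := Nat.succ_mul_centralBinom_succ m
    have key : (m + 1) ^ 2 * ((Nat.centralBinom (m + 1)) ^ 2 * (2 * (m + 1) + 1)) ≤
        (m + 1) ^ 2 * 16 ^ (m + 1) := by
      calc (m + 1) ^ 2 * ((Nat.centralBinom (m + 1)) ^ 2 * (2 * (m + 1) + 1)) 
          = ((m + 1) * Nat.centralBinom (m + 1)) ^ 2 * (2 * (m + 1) + 1) := by ring
        _ = ((Nat.centralBinom m) ^ 2 * (2 * m + 1)) * (4 * ((2 * m + 1) * (2 * m + 3))) := by
            rw [h]; ring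
        _ ≤ 16 ^ m * (4 * (4 * (m + 1) ^ 2)) := by
            exact Nat.mul_le_mul ih (by nlinarith)
        _ = _ := by ring
    exact Nat.le_of_mul_le_mul_left key (by positivity)

lemma choose_bound (j i : ℕ) : (j.choose i) ^ 2 * (j + 1) ≤ 4 ^ j := by
  have h0 : j.choose i ≤ j.choose (j / 2) := Nat.choose_le_middle i j
  refine (Nat.mul_le_mul_right _ (Nat.pow_le_pow_left h0 2)).trans ?_
  rcases Nat.even_or_odd' j with ⟨m, rfl | rfl⟩
  · have := central_bound m
    rw [Nat.centralBinom] at this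
    rw [Nat.mul_div_cancel_left _ (by norm_num), pow_mul]
    norm_num
    exact this
  · have h := central_bound (m + 1)
    have e : Nat.centralBinom (m + 1) = 2 * (2 * m + 1).choose m := by
      rw [Nat.centralBinom, show 2 * (m + 1) = 2 * m + 1 + 1 by ring, Nat.choose_succ_succ]
      have := Nat.choose_symm_half m
      rw [Nat.succ_eq_add_one] 
      omega
    rw [show (2 * m + 1) / 2 = m by omega]
    rw [e] at h
    have e4 : 4 ^ (2 * m + 1) = 4 * 16 ^ m := by rw [pow_succ, pow_mul]; norm_num; ring
    rw [e4]
    have : 4 * ((2 * m + 1).choose m ^ 2 * (2 * m + 1 + 1)) ≤ 4 * (4 * 16 ^ m) := by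
      calc _ ≤ (2 * (2 * m + 1).choose m) ^ 2 * (2 * (m + 1) + 1) := by
            rw [mul_pow, mul_assoc]; gcongr <;> norm_num
        _ ≤ 16 ^ (m + 1) := h
        _ = _ := by ring
    omega

lemma wlk_bound (j : ℕ) (y : ℤ) {δ : ℝ} (hδ : 0 < δ) :
    wlk j y ≤ 2 ^ j * (δ + 1 / (δ * (1 + j))) := by
  by_cases h : ∃ i : ℕ, y = 2 * i - j
  · obtain ⟨i, rfl⟩ := h
    rw [(wlk_eq j).1 i]
    have hb := choose_bound j i
    have hb' : (j.choose i : ℝ) ^ 2 * (j + 1) ≤ (2 ^ j) ^ 2 := by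
      rw [← pow_mul, mul_comm j 2, pow_mul]; norm_num
      exact_mod_cast hb
    set A := (j.choose i : ℝ)
    set B := (2 : ℝ) ^ j with hB
    have hBp : 0 < B := by positivity
    have hA : 0 ≤ A := by positivity
    have hj : (0 : ℝ) < 1 + j := by positivity
    have e : B * (δ + 1 / (δ * (1 + j))) = (B * (δ ^ 2 * (1 + j) + 1)) / (δ * (1 + j)) := by
      field_simp
    rw [e, le_div_iff₀ (by positivity)]
    -- A δ (1+j) ≤ B (δ²(1+j) + 1)
    have hs : 0 ≤ (A * δ * (1 + j)) := by positivity
    apply le_of_sq_le_sq _ (by positivity)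
    calc (A * (δ * (1 + j))) ^ 2 = (A ^ 2 * (j + 1)) * (δ ^ 2 * (1 + j)) := by ring
      _ ≤ B ^ 2 * (δ ^ 2 * (1 + j)) := by gcongr
      _ ≤ B ^ 2 * (δ ^ 2 * (1 + j) + 1) ^ 2 := by
          gcongr
          nlinarith [show 0 ≤ δ ^ 2 * (1 + j) by positivity]
      _ = _ := by ring
  · push Not at h
    rw [(wlk_eq j).2 y h]
    positivity

def cnt (T M n a x : ℕ) : ℕ := ((Finset.range n).filter (fun i => x / T ^ (i + 1) % M = a)).card

lemma cnt_succ (T M n a x : ℕ) : cnt T M (n + 1) a x = 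
    cnt T M n a x + if x / T ^ (n + 1) % M = a then 1 else 0 := by
  unfold cnt
  rw [Finset.range_add_one, Finset.filter_insert]
  split_ifs with h
  · rw [Finset.card_insert_of_notMem (by simp)]
  · rfl

lemma digit_add {T M : ℕ} (hT : 0 < T) (hMT : M ∣ T) {n i : ℕ} (hi : i < n) (x y : ℕ) :
    (x + T ^ (n + 1) * y) / T ^ (i + 1) % M = x / T ^ (i + 1) % M := by
  have e : T ^ (n + 1) * y = T ^ (i + 1) * (T * (T ^ (n - i - 1) * y)) := by
    rw [show n + 1 = (i + 1) + (1 + (n - i - 1)) by omega, pow_add, pow_add]; ring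
  rw [e, Nat.add_mul_div_left _ _ (by positivity)]
  obtain ⟨K, rfl⟩ := hMT
  rw [mul_assoc, Nat.add_mul_mod_self_left]

lemma cnt_add {T M : ℕ} (hT : 0 < T) (hMT : M ∣ T) (n a x y : ℕ) :
    cnt T M n a (x + T ^ (n + 1) * y) = cnt T M n a x := by
  unfold cnt
  congr 1
  refine Finset.filter_congr fun i hi => ?_
  rw [digit_add hT hMT (Finset.mem_range.1 hi)]

lemma step_sum (M : ℕ) {a b : ℕ} (ha : a < M) (hb : b < M) (hab : a ≠ b) (G : ℤ → ℝ) (y : ℤ) (K : ℕ) :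
    ∑ c ∈ Finset.range (M * K), G (y - ((if c % M = a then 1 else 0) - (if c % M = b then 1 else 0))) 
    = K * ((M - 2) * G y + (G (y - 1) + G (y + 1))) := by
  rw [sum_range_mul_split]
  simp only [Nat.add_mul_mod_self_left]
  rw [Finset.sum_const, Finset.card_range, nsmul_eq_mul]
  congr 1
  have : ∀ r ∈ Finset.range M, G (y - ((if r % M = a then 1 else 0) - (if r % M = b then 1 else 0))) 
     = G y + ((if r = a then G (y - 1) - G y else 0) + (if r = b then G (y + 1) - G y else 0)) := by
    intro r hr
    rw [Nat.mod_eq_of_lt (Finset.mem_range.1 hr)]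
    by_cases h1 : r = a
    · subst h1; simp [hab]
    · by_cases h2 : r = b
      · subst h2; simp [h1]
      · simp [h1, h2]
  rw [Finset.sum_congr rfl this, Finset.sum_add_distrib, Finset.sum_add_distrib]
  simp [ha, hb]
  ring

lemma walk_sum {M : ℕ} (hM : 2 ≤ M) {a b : ℕ} (ha : a < M) (hb : b < M) (hab : a ≠ b) 
    {T : ℕ} (hT : 0 < T) (hMT : M ∣ T) {δ : ℝ} (hδ : 0 < δ) (n : ℕ) : ∀ (j : ℕ) (z : ℤ),
    ∑ x ∈ Finset.range (T ^ (n + 1)), wlk j (z - ((cnt T M n a x : ℤ) - cnt T M n b x)) ≤ 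
      T ^ (n + 1) * (2 ^ j * (δ + 1 / (δ * (1 + j + n / M)))) := by
  have hMr : (2 : ℝ) ≤ M := by exact_mod_cast hM
  induction n with
  | zero =>
    intro j z
    simp only [cnt]
    simp only [Finset.range_zero, Finset.filter_empty, Finset.card_empty, Finset.sum_const, 
      Finset.card_range, nsmul_eq_mul]
    have := wlk_bound j z hδ
    simp only [Nat.cast_zero, sub_zero, zero_div, add_zero]
    push_cast
    gcongr
  | succ n ih =>
    intro j z
    rw [pow_succ T (n + 1), sum_range_mul_split, Finset.sum_comm]
    have key : ∀ x ∈ Finset.range (T ^ (n + 1)), ∑ c ∈ Finset.range T, 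
        wlk j (z - ((cnt T M (n + 1) a (x + T ^ (n + 1) * c) : ℤ) - 
          cnt T M (n + 1) b (x + T ^ (n + 1) * c))) = 
        (T / M : ℝ) * ((M - 2) * wlk j (z - ((cnt T M n a x : ℤ) - cnt T M n b x)) + 
          wlk (j + 1) (z - ((cnt T M n a x : ℤ) - cnt T M n b x))) := by
      intro x hx
      have hx' := Finset.mem_range.1 hx
      have hd : ∀ c, (x + T ^ (n + 1) * c) / T ^ (n + 1) = c := by
        intro c
        rw [Nat.add_mul_div_left _ _ (by positivity), Nat.div_eq_of_lt hx', zero_add]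
      obtain ⟨K, hK⟩ := hMT
      have hs := step_sum M ha hb hab (wlk j) (z - ((cnt T M n a x : ℤ) - cnt T M n b x)) K
      have hTK : (T / M : ℝ) = K := by rw [hK]; push_cast; field_simp
      rw [hTK, wlk, ← hs, ← hK]
      refine Finset.sum_congr rfl fun c _ => ?_
      rw [cnt_succ, cnt_succ, hd, cnt_add hT ⟨K, hK⟩, cnt_add hT ⟨K, hK⟩]
      congr 1
      push_cast
      ring
    rw [Finset.sum_congr rfl key, ← Finset.mul_sum, Finset.sum_add_distrib, ← Finset.mul_sum]
    have h1 := ih j z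
    have h2 := ih (j + 1) z
    set A := ∑ x ∈ Finset.range (T ^ (n + 1)), wlk j (z - ((cnt T M n a x : ℤ) - cnt T M n b x))
    set B := ∑ x ∈ Finset.range (T ^ (n + 1)), wlk (j + 1) (z - ((cnt T M n a x : ℤ) - cnt T M n b x))
    set t : ℝ := 1 + j + n / M with ht
    have ht1 : 1 ≤ t := by 
      have : (0 : ℝ) ≤ j + n / M := by positivity
      linarith
    have ht0 : 0 < t := by linarith
    have e2 : (1 + ((j + 1 : ℕ) : ℝ) + n / M) = t + 1 := by push_cast; ring
    have e3 : (1 + (j : ℝ) + ((n + 1 : ℕ) : ℝ) / M) = t + 1 / M := by push_cast; ring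
    rw [e2] at h2
    rw [e3]
    have hconv : (1 - 2 / (M : ℝ)) * (1 / (δ * t)) + (2 / M) * (1 / (δ * (t + 1))) ≤ 
        1 / (δ * (t + 1 / M)) := by
      have hm0 : (0 : ℝ) < M := by linarith
      have e : (1 - 2 / (M : ℝ)) * (1 / (δ * t)) + (2 / M) * (1 / (δ * (t + 1))) = 
        ((M - 2) * (t + 1) + 2 * t) / (M * δ * t * (t + 1)) := by field_simp
      have e' : 1 / (δ * (t + 1 / (M : ℝ))) = M / (δ * (M * t + 1)) := by field_simp
      rw [e, e', div_le_div_iff₀ (by positivity) (by positivity)]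
      have : ((M - 2) * (t + 1) + 2 * t) * (M * t + 1) ≤ (M : ℝ) * (M * t * (t + 1)) := by
        nlinarith
      nlinarith
    have hm0 : (0 : ℝ) < M := by linarith
    have hT0 : (0 : ℝ) < T := by exact_mod_cast hT
    calc (T / M : ℝ) * ((M - 2) * A + B) 
        ≤ (T / M : ℝ) * ((M - 2) * (T ^ (n + 1) * (2 ^ j * (δ + 1 / (δ * t)))) + 
            T ^ (n + 1) * (2 ^ (j + 1) * (δ + 1 / (δ * (t + 1))))) := by
          gcongr
      _ = (T : ℝ) ^ (n + 1) * T * (2 ^ j * (δ + ((1 - 2 / (M : ℝ)) * (1 / (δ * t)) + 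
            (2 / M) * (1 / (δ * (t + 1)))))) := by
          rw [pow_succ 2 j]
          field_simp
          ring
      _ ≤ _ := by
          push_cast
          rw [pow_succ (T : ℝ) (n + 1)]
          gcongr

lemma anticonc {M : ℕ} (hM : 2 ≤ M) (k : ℕ) {ε : ℝ} (hε : 0 < ε) :
    ∃ n : ℕ, 2 * k < n ∧ ∀ T : ℕ, 0 < T → M ∣ T → 
      (((Finset.range (T ^ (n + 1))).filter (fun x => ∃ a < M, ∃ b < M, a ≠ b ∧ 
        cnt T M n a x ≤ cnt T M n b x + 2 * k ∧ cnt T M n b x ≤ cnt T M n a x)).card : ℝ) ≤ 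
        ε * T ^ (n + 1) := by
  classical
  have hMr : (2 : ℝ) ≤ M := by exact_mod_cast hM
  set W : ℝ := M * M * (2 * k + 1) with hW
  have hWp : 0 < W := by positivity
  set δ := ε / (2 * W) with hδ
  have hδp : 0 < δ := by positivity
  obtain ⟨n0, hn0⟩ := exists_nat_gt (M * (2 * W / (ε * δ)) : ℝ)
  refine ⟨n0 + (2 * k + 1), by omega, fun T hT hMT => ?_⟩
  set n := n0 + (2 * k + 1) with hn
  have hT0 : (0 : ℝ) < T := by exact_mod_cast hT
  have single : ∀ a < M, ∀ b < M, a ≠ b → ∀ z : ℤ, 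
      (((Finset.range (T ^ (n + 1))).filter (fun x => (cnt T M n a x : ℤ) - cnt T M n b x = z)).card : ℝ)
       ≤ T ^ (n + 1) * (ε / W) := by
    intro a ha b hb hab z
    have h := walk_sum hM ha hb hab hT hMT hδp n 0 z
    have e : ∑ x ∈ Finset.range (T ^ (n + 1)), wlk 0 (z - ((cnt T M n a x : ℤ) - cnt T M n b x)) = 
      (((Finset.range (T ^ (n + 1))).filter (fun x => (cnt T M n a x : ℤ) - cnt T M n b x = z)).card : ℝ) := by
      simp only [wlk]
      rw [Finset.card_filter]
      push_cast
      refine Finset.sum_congr rfl fun x _ => ?_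
      congr 1
      rw [sub_eq_zero]
      exact propext eq_comm
    rw [← e]
    refine h.trans ?_
    gcongr
    have h1 : δ = ε / W / 2 := by rw [hδ]; field_simp
    have h2 : 1 / (δ * (1 + ((0 : ℕ) : ℝ) + n / M)) ≤ ε / W / 2 := by
      rw [div_le_iff₀ (by positivity)]
      have h3 : 2 * W / (ε * δ) ≤ n / M := by
        rw [le_div_iff₀ (by positivity), mul_comm]
        refine hn0.le.trans ?_
        rw [hn]; push_cast; 
        have : (0 : ℝ) ≤ 2 * k + 1 := by positivity
        linarith
      calc (1 : ℝ) = ε / W / 2 * (δ * (2 * W / (ε * δ))) := by field_simp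
        _ ≤ ε / W / 2 * (δ * (1 + ((0 : ℕ) : ℝ) + n / M)) := by
          gcongr
          push_cast
          linarith
    rw [pow_zero, one_mul]
    linarith
  have hsub : (Finset.range (T ^ (n + 1))).filter (fun x => ∃ a < M, ∃ b < M, a ≠ b ∧ 
        cnt T M n a x ≤ cnt T M n b x + 2 * k ∧ cnt T M n b x ≤ cnt T M n a x) ⊆ 
      ((Finset.range M ×ˢ Finset.range M).filter (fun p => p.1 ≠ p.2) ×ˢ Finset.range (2 * k + 1)).biUnion 
        (fun p => (Finset.range (T ^ (n + 1))).filter 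
          (fun x => (cnt T M n p.1.1 x : ℤ) - cnt T M n p.1.2 x = p.2)) := by
    intro x hx
    rw [Finset.mem_filter] at hx
    obtain ⟨hx1, a, ha, b, hb, hab, h1, h2⟩ := hx
    rw [Finset.mem_biUnion]
    refine ⟨((a, b), cnt T M n a x - cnt T M n b x), ?_, ?_⟩
    · simp [ha, hb, hab]; omega
    · simp only [Finset.mem_filter]
      refine ⟨hx1, ?_⟩
      push_cast [h2]; ring
  have hc := (Finset.card_le_card hsub).trans Finset.card_biUnion_le
  have hc' : ((((Finset.range (T ^ (n + 1))).filter (fun x => ∃ a < M, ∃ b < M, a ≠ b ∧ 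
        cnt T M n a x ≤ cnt T M n b x + 2 * k ∧ cnt T M n b x ≤ cnt T M n a x)).card : ℕ) : ℝ) ≤ 
      ((∑ p ∈ ((Finset.range M ×ˢ Finset.range M).filter (fun p => p.1 ≠ p.2) ×ˢ Finset.range (2 * k + 1)), 
        ((Finset.range (T ^ (n + 1))).filter 
          (fun x => (cnt T M n p.1.1 x : ℤ) - cnt T M n p.1.2 x = p.2)).card : ℕ) : ℝ) := by
    exact_mod_cast hc
  refine hc'.trans ?_
  push_cast
  have hb : ∀ p ∈ ((Finset.range M ×ˢ Finset.range M).filter (fun p => p.1 ≠ p.2) ×ˢ Finset.range (2 * k + 1)),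
     (((Finset.range (T ^ (n + 1))).filter 
          (fun x => (cnt T M n p.1.1 x : ℤ) - cnt T M n p.1.2 x = p.2)).card : ℝ) ≤ T ^ (n + 1) * (ε / W) := by
    intro p hp
    simp only [Finset.mem_product, Finset.mem_filter, Finset.mem_range] at hp
    exact single _ hp.1.1.1 _ hp.1.1.2 hp.1.2 _
  refine (Finset.sum_le_sum hb).trans ?_
  rw [Finset.sum_const, nsmul_eq_mul]
  have hcard : ((((Finset.range M ×ˢ Finset.range M).filter (fun p => p.1 ≠ p.2) ×ˢ Finset.range (2 * k + 1)).card : ℕ) : ℝ) ≤ W := by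
    rw [Finset.card_product]
    have := Finset.card_filter_le (Finset.range M ×ˢ Finset.range M) (fun p => p.1 ≠ p.2)
    rw [Finset.card_product] at this
    simp only [Finset.card_range] at this ⊢
    rw [hW]
    exact_mod_cast Nat.mul_le_mul_right _ this
  calc _ ≤ W * (T ^ (n + 1) * (ε / W)) := by gcongr
    _ = _ := by field_simp


def IsWin (T M n k x a : ℕ) : Prop := a < M ∧ ∀ b < M, b ≠ a → cnt T M n b x + 2 * k < cnt T M n a x

open Classical in
noncomputable def Jw (T M n k x : ℕ) : ℕ := if h : ∃ a, IsWin T M n k x a then h.choose else 0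

lemma IsWin.unique {T M n k x a b : ℕ} (ha : IsWin T M n k x a) (hb : IsWin T M n k x b) : a = b := by
  by_contra h
  have h1 := ha.2 b hb.1 (Ne.symm h)
  have h2 := hb.2 a ha.1 h
  omega

lemma Jw_eq {T M n k x a : ℕ} (ha : IsWin T M n k x a) : Jw T M n k x = a := by
  have h : ∃ a, IsWin T M n k x a := ⟨a, ha⟩
  rw [Jw, dif_pos h]
  exact h.choose_spec.unique ha

lemma IsWin_congr {T M n k x y : ℕ} (h : ∀ a, cnt T M n a x = cnt T M n a y) :
    IsWin T M n k x = IsWin T M n k y := by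
  funext a
  simp only [IsWin, h]

lemma Jw_congr {T M n k x y : ℕ} (h : ∀ a, cnt T M n a x = cnt T M n a y) :
    Jw T M n k x = Jw T M n k y := by
  by_cases hx : ∃ a, IsWin T M n k x a
  · obtain ⟨a, ha⟩ := hx
    rw [Jw_eq ha, Jw_eq (IsWin_congr h ▸ ha)]
  · have hy : ¬ ∃ a, IsWin T M n k y a := by rwa [← IsWin_congr h]
    rw [Jw, Jw, dif_neg hx, dif_neg hy]

lemma cnt_low {T M n a x y : ℕ} (h : x / T = y / T) : cnt T M n a x = cnt T M n a y := by
  unfold cnt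
  congr 1
  refine Finset.filter_congr fun i _ => ?_
  rw [pow_succ', ← Nat.div_div_eq_div_mul, ← Nat.div_div_eq_div_mul, h]

lemma noWin {T M n k x : ℕ} (hM : 0 < M) (h : ¬ ∃ a, IsWin T M n k x a) :
    ∃ a < M, ∃ b < M, a ≠ b ∧ 
        cnt T M n a x ≤ cnt T M n b x + 2 * k ∧ cnt T M n b x ≤ cnt T M n a x := by
  obtain ⟨a, ha, hmax⟩ := Finset.exists_max_image (Finset.range M) (fun a => cnt T M n a x)
    ⟨0, Finset.mem_range.2 hM⟩
  rw [Finset.mem_range] at ha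
  by_contra hcon
  push Not at hcon
  apply h
  refine ⟨a, ha, fun b hb hba => ?_⟩
  by_contra h2
  have := hcon a ha b hb (Ne.symm hba) (by omega)
  have h3 := hmax b (Finset.mem_range.2 hb)
  omega

def CG (T R n x : ℕ) : Prop := ∀ i < n, R * (x % T ^ (i + 1)) + T ^ (i + 1) < R * T ^ (i + 1)

lemma low_bound {T R B C : ℕ} (hB : R * B ≤ T) (hC : 1 + R * C ≤ T) {u : ℕ} (hu : u ≤ B) 
    {c : ℕ → ℕ} (hc : ∀ i, c i ≤ C) (i : ℕ) :
    R * (u + ∑ l ∈ Finset.range i, c l * T ^ (l + 1)) ≤ T ^ (i + 1) := by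
  induction i with
  | zero => 
    simp
    exact (Nat.mul_le_mul_left _ hu).trans hB
  | succ i ih =>
    rw [Finset.sum_range_succ, ← add_assoc, mul_add]
    calc _ ≤ T ^ (i + 1) + R * (C * T ^ (i + 1)) := by
          gcongr; exact hc i
      _ = (1 + R * C) * T ^ (i + 1) := by ring
      _ ≤ T * T ^ (i + 1) := by gcongr
      _ = _ := by ring

lemma split_sum {T M : ℕ} (hMT : M ∣ T) (c : ℕ → ℕ) (i n : ℕ) (hi : i + 1 ≤ n) :
    ∃ z, ∑ l ∈ Finset.range n, c l * T ^ (l + 1) = 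
      ∑ l ∈ Finset.range i, c l * T ^ (l + 1) + T ^ (i + 1) * (c i + M * z) := by
  induction n, hi using Nat.le_induction with
  | base => exact ⟨0, by rw [Finset.sum_range_succ]; ring⟩
  | succ n hn ih =>
    obtain ⟨z, hz⟩ := ih
    obtain ⟨K, hK⟩ := hMT
    refine ⟨z + c n * K * T ^ (n - i - 1), ?_⟩
    rw [Finset.sum_range_succ, hz]
    have : T ^ (n + 1) = T ^ (i + 1) * (M * K * T ^ (n - i - 1)) := by
      rw [← hK, show n + 1 = (i + 1) + (1 + (n - i - 1)) by omega, pow_add T (i+1), pow_add T 1, pow_one T]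
    rw [this]; ring

lemma shift_digit {T M R B C n : ℕ} (hMT : M ∣ T) (hB : R * B ≤ T) (hC : 1 + R * C ≤ T) 
    {u : ℕ} (hu : u ≤ B) {c : ℕ → ℕ} (hc : ∀ i, c i ≤ C) {x : ℕ} (hx : CG T R n x) 
    {i : ℕ} (hi : i < n) :
    (x + (u + ∑ l ∈ Finset.range n, c l * T ^ (l + 1))) / T ^ (i + 1) % M = 
      (x / T ^ (i + 1) + c i) % M := by
  obtain ⟨z, hz⟩ := split_sum hMT c i n hi
  rw [hz]
  have hl := low_bound hB hC hu hc i
  have hxi := hx i hi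
  set t := T ^ (i + 1) with ht
  set e := u + ∑ l ∈ Finset.range i, c l * T ^ (l + 1) with he
  have hlt : x % t + e < t := by
    have : R * (x % t + e) < R * t := by rw [mul_add]; omega
    exact Nat.lt_of_mul_lt_mul_left this
  have ht0 : 0 < t := by omega
  have e1 : x + (u + (∑ l ∈ Finset.range i, c l * T ^ (l + 1) + t * (c i + M * z))) = 
      (x % t + e) + t * (x / t + c i + M * z) := by
    rw [he]
    have := Nat.mod_add_div x t
    conv_lhs => rw [← this]
    ring
  rw [e1, Nat.add_mul_div_left _ _ ht0, Nat.div_eq_of_lt hlt, zero_add, Nat.add_mul_mod_self_left]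

lemma cnt_shift {T M n k x x' : ℕ} (hM : 0 < M) {c : ℕ → ℕ} 
    (hk : ((Finset.range n).filter (fun i => ¬ c i % M = 1 % M)).card ≤ k) 
    (h : ∀ i < n, x' / T ^ (i + 1) % M = (x / T ^ (i + 1) + c i) % M) {a : ℕ} (ha : a < M) :
    cnt T M n a x ≤ cnt T M n ((a + 1) % M) x' + k ∧ 
    cnt T M n ((a + 1) % M) x' ≤ cnt T M n a x + k := by
  have hg : ∀ i < n, c i % M = 1 % M → x' / T ^ (i + 1) % M = (x / T ^ (i + 1) + 1) % M := by
    intro i hi h1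
    rw [h i hi]
    exact Nat.ModEq.add_left _ h1
  constructor
  · refine le_trans (le_trans (Finset.card_le_card ?_) (Finset.card_union_le _ _)) (Nat.add_le_add_left hk _)
    intro i hi
    simp only [Finset.mem_filter, Finset.mem_union, Finset.mem_range] at hi ⊢
    by_cases hc : c i % M = 1 % M
    · left
      refine ⟨hi.1, ?_⟩
      rw [hg i hi.1 hc, Nat.add_mod, hi.2, Nat.add_mod_mod]
    · right; exact ⟨hi.1, hc⟩
  · refine le_trans (le_trans (Finset.card_le_card ?_) (Finset.card_union_le _ _)) (Nat.add_le_add_left hk _)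
    intro i hi
    simp only [Finset.mem_filter, Finset.mem_union, Finset.mem_range] at hi ⊢
    by_cases hc : c i % M = 1 % M
    · left
      refine ⟨hi.1, ?_⟩
      have h1 := hi.2
      rw [hg i hi.1 hc] at h1
      have h2 : x / T ^ (i + 1) ≡ a [MOD M] := Nat.ModEq.add_right_cancel' 1 h1
      rw [h2, Nat.mod_eq_of_lt ha]
    · right; exact ⟨hi.1, hc⟩

lemma win_shift {T M n k x x' : ℕ} (hM : 0 < M) {c : ℕ → ℕ} 
    (hk : ((Finset.range n).filter (fun i => ¬ c i % M = 1 % M)).card ≤ k) 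
    (h : ∀ i < n, x' / T ^ (i + 1) % M = (x / T ^ (i + 1) + c i) % M) {a a' : ℕ} 
    (ha : IsWin T M n k x a) (ha' : IsWin T M n k x' a') : a' = (a + 1) % M := by
  by_contra hne
  set b := (a' + (M - 1)) % M with hb
  have hbM : b < M := Nat.mod_lt _ hM
  have hb1 : (b + 1) % M = a' := by
    rw [hb, Nat.mod_add_mod, show a' + (M - 1) + 1 = a' + M by omega, Nat.add_mod_right, 
      Nat.mod_eq_of_lt ha'.1]
  have hba : b ≠ a := by
    intro h; rw [h] at hb1; exact hne hb1.symm
  have h1 := ha.2 b hbM hba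
  have h2 := ha'.2 ((a + 1) % M) (Nat.mod_lt _ hM) (Ne.symm hne)
  have h3 := (cnt_shift hM hk h ha.1).1
  have h4 := (cnt_shift hM hk h hbM).2
  rw [hb1] at h4
  omega

lemma carry_count {T R n : ℕ} (hT : 0 < T) (hR : 0 < R) (hRT : R ∣ T) :
    (((Finset.range (T ^ (n + 1))).filter (fun x => ∃ i < n, 
      R * T ^ (i + 1) ≤ R * (x % T ^ (i + 1)) + T ^ (i + 1))).card : ℝ) ≤ n / R * T ^ (n + 1) := by
  classical
  have single : ∀ i ∈ Finset.range n, (((Finset.range (T ^ (n + 1))).filter (fun x => 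
      R * T ^ (i + 1) ≤ R * (x % T ^ (i + 1)) + T ^ (i + 1))).card : ℝ) ≤ 1 / R * T ^ (n + 1) := by
    intro i hi
    rw [Finset.mem_range] at hi
    have hd : R ∣ T ^ (i + 1) := dvd_pow hRT (by omega)
    obtain ⟨m, hm⟩ := hd
    set t := T ^ (i + 1) with ht
    have ht0 : 0 < t := by positivity
    have e : T ^ (n + 1) = t * T ^ (n - i) := by rw [ht, ← pow_add]; congr 1; omega
    rw [e, Finset.card_filter, sum_range_mul_split]
    have inner : ∀ y ∈ Finset.range (T ^ (n - i)), ∑ r ∈ Finset.range t, 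
        (if R * t ≤ R * ((r + t * y) % t) + t then 1 else 0) ≤ m := by
      intro y _
      rw [← Finset.card_filter]
      have : (Finset.range t).filter (fun r => R * t ≤ R * ((r + t * y) % t) + t) ⊆ 
          Finset.Ico (t - m) t := by
        intro r hr
        simp only [Finset.mem_filter, Finset.mem_range, Nat.add_mul_mod_self_left] at hr
        rw [Nat.mod_eq_of_lt hr.1] at hr
        rw [Finset.mem_Ico]
        refine ⟨?_, hr.1⟩
        have h2 : R * t ≤ R * (r + m) := by rw [mul_add, ← hm]; exact hr.2
        have := Nat.le_of_mul_le_mul_left h2 hR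
        omega
      refine (Finset.card_le_card this).trans ?_
      rw [Nat.card_Ico]; omega
    have h1 := Finset.sum_le_sum inner
    rw [Finset.sum_const, Finset.card_range, smul_eq_mul] at h1
    have h2 : ((∑ y ∈ Finset.range (T ^ (n - i)), ∑ r ∈ Finset.range t, 
        (if R * t ≤ R * ((r + t * y) % t) + t then 1 else 0) : ℕ) : ℝ) ≤ ((T ^ (n - i) * m : ℕ) : ℝ) := by
      exact_mod_cast h1
    refine h2.trans (le_of_eq ?_)
    have e' : (T : ℝ) ^ (n + 1) = R * m * T ^ (n - i) := by
      have : T ^ (n + 1) = R * m * T ^ (n - i) := by rw [e, hm]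
      exact_mod_cast this
    rw [e']
    have : (R : ℝ) ≠ 0 := by exact_mod_cast hR.ne'
    push_cast
    field_simp
  have hsub : (Finset.range (T ^ (n + 1))).filter (fun x => ∃ i < n, 
      R * T ^ (i + 1) ≤ R * (x % T ^ (i + 1)) + T ^ (i + 1)) ⊆ (Finset.range n).biUnion (fun i => 
      (Finset.range (T ^ (n + 1))).filter (fun x => 
      R * T ^ (i + 1) ≤ R * (x % T ^ (i + 1)) + T ^ (i + 1))) := by
    intro x hx
    simp only [Finset.mem_filter, Finset.mem_biUnion, Finset.mem_range] at hx ⊢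
    obtain ⟨h1, i, h2, h3⟩ := hx
    exact ⟨i, h2, h1, h3⟩
  have hc := (Finset.card_le_card hsub).trans Finset.card_biUnion_le
  have hc' := (Nat.cast_le (α := ℝ)).2 hc
  refine hc'.trans ?_
  push_cast
  refine (Finset.sum_le_sum single).trans ?_
  rw [Finset.sum_const, Finset.card_range, nsmul_eq_mul]
  apply le_of_eq; ring

lemma periodic_count {P : ℕ} (D : ℕ → Prop) [DecidablePred D] (hD : ∀ x, D (x + P) ↔ D x) (K m : ℕ) :
    ∑ r ∈ Finset.range (P * K), (if D (r + m) then 1 else 0) = 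
      K * ((Finset.range P).filter D).card := by
  have hper : Function.Periodic D P := fun x => propext (hD x)
  rw [sum_range_mul_split]
  have h : ∀ y ∈ Finset.range K, ∑ r ∈ Finset.range P, (if D (r + P * y + m) then 1 else 0) = 
      ((Finset.range P).filter D).card := by
    intro y _
    have e : ∀ r, D (r + P * y + m) ↔ D (m + r) := by
      intro r
      have := hper.nat_mul y (m + r)
      rw [← this]
      simp only [Nat.cast_id]
      rw [show r + P * y + m = m + r + y * P by ring]
    simp only [e]
    have h2 := Nat.filter_Ico_card_eq_of_periodic m P D hper
    rw [Nat.count_eq_card_filter_range] at h2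
    rw [← h2, Finset.card_filter, Finset.sum_Ico_eq_sum_range]
    simp
  rw [Finset.sum_congr rfl h]
  simp


/-- Stage of the construction. -/
structure Stg where
  P : ℕ
  f : ℕ → ZMod 2
  D : ℕ → Prop
  S : Set ℕ
  B : ℕ
  hP : 0 < P
  hf : ∀ x, f (x + P) = f x
  hD : ∀ x, D (x + P) ↔ D x
  hB : ∀ s ∈ S, s ≤ B
  flip : ∀ s ∈ S, ∀ x, ¬ D x → ¬ D (x + s) → f (x + s) = f x + 1

open Classical in
noncomputable def Stg.dens (st : Stg) : ℝ := ((Finset.range st.P).filter st.D).card / st.P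

lemma Stg.f_congr (st : Stg) {x y : ℕ} (h : x ≡ y [MOD st.P]) : st.f x = st.f y := by
  have hp : Function.Periodic st.f st.P := st.hf
  rw [← hp.map_mod_nat x, ← hp.map_mod_nat y, h]

lemma Stg.D_congr (st : Stg) {x y : ℕ} (h : x ≡ y [MOD st.P]) : st.D x ↔ st.D y := by
  have hp : Function.Periodic st.D st.P := fun x => propext (st.hD x)
  rw [← hp.map_mod_nat x, ← hp.map_mod_nat y, h]

def Hits (S : Set ℕ) (g d : ℕ) (η : ℝ) : Prop := ∀ β : Fin d → ℝ, ∃ s ∈ S, ∀ l, ∃ p : ℤ, 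
  |((s : ℝ) - g) * β l - p| ≤ η

lemma CG_add {T R n x : ℕ} : CG T R n (x + T ^ (n + 1)) ↔ CG T R n x := by
  unfold CG
  refine forall₂_congr fun i hi => ?_
  have : T ^ (n + 1) = T ^ (i + 1) * T ^ (n - i) := by rw [← pow_add]; congr 1; omega
  rw [this, Nat.add_mul_mod_self_left]

lemma step (st : Stg) (g d : ℕ) {η ε : ℝ} (hη : 0 < η) (hε : 0 < ε) :
    ∃ st' : Stg, st.S ⊆ st'.S ∧ st'.dens ≤ st.dens + ε ∧ st.P < st'.P ∧ 
      (∀ x < st.P, st'.f x = st.f x ∧ (st'.D x ↔ st.D x)) ∧ Hits st'.S g d η := by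
  classical
  obtain ⟨M, hMdef⟩ : ∃ M, M = 2 * st.P := ⟨_, rfl⟩
  have hPpos := st.hP
  have hM2 : 2 ≤ M := by omega
  have hM : 0 < M := by omega
  have hPM : st.P ∣ M := ⟨2, by omega⟩
  obtain ⟨k, hk⟩ : ∃ k, k = M ^ d := ⟨_, rfl⟩
  obtain ⟨n, hnk, hanti⟩ := anticonc hM2 k (half_pos hε)
  obtain ⟨C, hC⟩ := bohrC M d n hM hη
  obtain ⟨R0, hR0⟩ := exists_nat_gt (n / (ε / 2) : ℝ)
  obtain ⟨R, hR⟩ : ∃ R, R = R0 + 2 := ⟨_, rfl⟩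
  have hRpos : 0 < R := by omega
  have hnR : (n / R : ℝ) ≤ ε / 2 := by
    rw [div_le_iff₀ (by positivity)]
    rw [div_lt_iff₀ (by positivity)] at hR0
    have : (R0 : ℝ) ≤ R := by rw [hR]; push_cast; linarith
    nlinarith
  obtain ⟨B, hBdef⟩ : ∃ B, B = st.B + g := ⟨_, rfl⟩
  obtain ⟨T, hTdef⟩ : ∃ T, T = M * R * (1 + C + B) := ⟨_, rfl⟩
  have hMT : M ∣ T := ⟨R * (1 + C + B), by rw [hTdef]; ring⟩
  have hRT : R ∣ T := ⟨M * (1 + C + B), by rw [hTdef]; ring⟩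
  have hPT : st.P ∣ T := hPM.trans hMT
  have hTR : R * (1 + C + B) ≤ T := by
    rw [hTdef, mul_assoc]; exact Nat.le_mul_of_pos_left _ hM
  have hRB : R * B ≤ T := le_trans (Nat.mul_le_mul_left _ (by omega)) hTR
  have hRC : 1 + R * C ≤ T := by
    refine le_trans ?_ hTR
    rw [mul_add, mul_add]; omega
  have hTMR : 2 * (R * st.P) ≤ T := by
    rw [hTdef]
    calc 2 * (R * st.P) = M * R * 1 := by rw [hMdef]; ring
      _ ≤ _ := Nat.mul_le_mul_left _ (by omega)
  have hT : 0 < T := by omega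
  have hPltT : st.P < T := by nlinarith
  -- new objects
  let w : ℕ := (st.P - 1) * g
  let J : ℕ → ℕ := Jw T M n k
  let f' : ℕ → ZMod 2 := fun x => st.f (x + J x * w) + J x
  let D' : ℕ → Prop := fun x => ¬ CG T R n x ∨ ¬ (∃ a, IsWin T M n k x a) ∨ st.D (x + J x * w)
  let S1 : Set ℕ := {s | ∃ c : ℕ → ℕ, (∀ i, c i ≤ C) ∧ 
    ((Finset.range n).filter (fun i => ¬ c i % M = 1 % M)).card ≤ k ∧ 
    s = g + ∑ i ∈ Finset.range n, c i * T ^ (i + 1)}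
  have hcntper : ∀ a x, cnt T M n a (x + T ^ (n + 1)) = cnt T M n a x := by
    intro a x
    have := cnt_add hT hMT n a x 1
    rwa [mul_one] at this
  have hJper : ∀ x, J (x + T ^ (n + 1)) = J x := fun x => Jw_congr fun a => hcntper a x
  have hPTn : st.P ∣ T ^ (n + 1) := hPT.trans (dvd_pow_self _ (by omega))
  have hmodper : ∀ x y, x + T ^ (n + 1) + y ≡ x + y [MOD st.P] := by
    intro x y
    have : x + T ^ (n + 1) + y = (x + y) + T ^ (n + 1) := by ring
    rw [this]
    exact (Nat.modEq_of_dvd (by push_cast; simpa using (by exact_mod_cast hPTn))).symm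
  have hold : ∀ s ≤ B, ∀ x, CG T R n x → ∀ a, cnt T M n a (x + s) = cnt T M n a x := by
    intro s hs x hx a
    unfold cnt
    congr 1
    refine Finset.filter_congr fun i hi => ?_
    have := shift_digit hMT hRB hRC hs (c := fun _ => 0) (fun _ => Nat.zero_le _) hx (Finset.mem_range.1 hi)
    simp only [zero_mul, Finset.sum_const_zero, add_zero] at this
    rw [this]
  have hTdvdsum : ∀ c : ℕ → ℕ, st.P ∣ ∑ i ∈ Finset.range n, c i * T ^ (i + 1) := by
    intro c
    refine Finset.dvd_sum fun i _ => Dvd.dvd.mul_left (hPT.trans (dvd_pow_self _ (by omega))) _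
  let st' : Stg := 
    { P := T ^ (n + 1)
      f := f'
      D := D'
      S := st.S ∪ S1
      B := B + ∑ i ∈ Finset.range n, C * T ^ (i + 1)
      hP := by positivity
      hf := by
        intro x
        simp only [f']
        rw [hJper, st.f_congr (hmodper x _)]
      hD := by
        intro x
        simp only [D']
        rw [hJper, st.D_congr (hmodper x _), CG_add, IsWin_congr (hcntper · x)]
      hB := by
        rintro s (hs | ⟨c, hc, _, rfl⟩)
        · have := st.hB s hs
          omega
        · have : ∑ i ∈ Finset.range n, c i * T ^ (i + 1) ≤ ∑ i ∈ Finset.range n, C * T ^ (i + 1) :=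
            Finset.sum_le_sum fun i _ => Nat.mul_le_mul_right _ (hc i)
          omega
      flip := by
        rintro s (hs | ⟨c, hc, hck, rfl⟩) x hx hxs
        · simp only [D', not_or, not_not] at hx hxs
          have hsB : s ≤ B := by have := st.hB s hs; omega
          have hJ : J (x + s) = J x := Jw_congr fun a => hold s hsB x hx.1 a
          simp only [f']
          rw [hJ] at hxs ⊢
          have e : x + s + J x * w = x + J x * w + s := by ring
          rw [e] at hxs ⊢
          rw [st.flip s hs _ hx.2.2 hxs.2.2]
          ring
        · simp only [D', not_or, not_not] at hx hxs
          obtain ⟨a, ha⟩ := hx.2.1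
          obtain ⟨a', ha'⟩ := hxs.2.1
          have hdig := fun i (hi : i < n) => shift_digit hMT hRB hRC (u := g) (by omega) hc hx.1 hi
          have haa := win_shift hM hck hdig ha ha'
          have hJ : J x = a := Jw_eq ha
          have hJ' : J (x + (g + ∑ i ∈ Finset.range n, c i * T ^ (i + 1))) = a' := Jw_eq ha'
          simp only [f', hJ, hJ']
          have hmodP : a' ≡ a + 1 [MOD st.P] := by
            rw [haa]
            exact Nat.ModEq.of_dvd hPM (Nat.mod_modEq _ _)
          have hmod2 : a' ≡ a + 1 [MOD 2] := by
            rw [haa]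
            exact Nat.ModEq.of_dvd ⟨st.P, hMdef⟩ (Nat.mod_modEq _ _)
          have hz2 : (a' : ZMod 2) = a + 1 := by
            have := (ZMod.natCast_eq_natCast_iff _ _ _).2 hmod2
            simpa using this
          have hcong : x + (g + ∑ i ∈ Finset.range n, c i * T ^ (i + 1)) + a' * w ≡ x + a * w [MOD st.P] := by
            obtain ⟨z, hz⟩ := hTdvdsum c
            have hgw : g + w = st.P * g := by
              simp only [w]
              obtain ⟨p, hp⟩ : ∃ p, st.P = p + 1 := ⟨st.P - 1, by omega⟩
              rw [hp]; simp; ring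
            calc x + (g + ∑ i ∈ Finset.range n, c i * T ^ (i + 1)) + a' * w 
                ≡ x + (g + ∑ i ∈ Finset.range n, c i * T ^ (i + 1)) + (a + 1) * w [MOD st.P] := 
                  Nat.ModEq.add_left _ (Nat.ModEq.mul_right _ hmodP)
              _ = x + a * w + st.P * (g + z) := by rw [hz, mul_add, ← hgw]; ring
              _ ≡ x + a * w [MOD st.P] := by
                  simp [Nat.ModEq]
          rw [st.f_congr hcong, hz2]
          ring }
  refine ⟨st', Set.subset_union_left, ?_, ?_, ?_, ?_⟩
  · -- density
    have hTr : (0 : ℝ) < (T : ℝ) ^ (n + 1) := by positivity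
    have hPr : (0 : ℝ) < st.P := by exact_mod_cast hPpos
    have h3 : (((Finset.range (T ^ (n + 1))).filter (fun x => st.D (x + J x * w))).card : ℝ) = 
        st.dens * T ^ (n + 1) := by
      have hn : ((Finset.range (T ^ (n + 1))).filter (fun x => st.D (x + J x * w))).card = 
          T ^ n * ((T / st.P) * ((Finset.range st.P).filter st.D).card) := by
        rw [Finset.card_filter, pow_succ', sum_range_mul_split]
        have : ∀ y ∈ Finset.range (T ^ n), ∑ r ∈ Finset.range T, 
            (if st.D (r + T * y + J (r + T * y) * w) then 1 else 0) = 
            (T / st.P) * ((Finset.range st.P).filter st.D).card := by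
          intro y _
          rw [← periodic_count st.D st.hD (T / st.P) (T * y + J (T * y) * w), Nat.mul_div_cancel' hPT]
          refine Finset.sum_congr rfl fun r hr => ?_
          have hJr : J (r + T * y) = J (T * y) := by
            refine Jw_congr fun a => cnt_low ?_
            rw [Nat.add_mul_div_left _ _ hT, Nat.div_eq_of_lt (Finset.mem_range.1 hr), zero_add, 
              Nat.mul_div_cancel_left _ hT]
          rw [hJr, add_assoc]
        rw [Finset.sum_congr rfl this, Finset.sum_const, Finset.card_range, smul_eq_mul]
      rw [hn]
      obtain ⟨K, hK⟩ := hPT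
      have hTK : T / st.P = K := by rw [hK]; exact Nat.mul_div_cancel_left _ hPpos
      rw [hTK, Stg.dens]
      have hTr' : (T : ℝ) = st.P * K := by exact_mod_cast hK
      push_cast
      rw [pow_succ]
      rw [div_mul_eq_mul_div, eq_div_iff hPr.ne', hTr']
      ring
    have h1 := carry_count (n := n) hT hRpos hRT
    have h2 := hanti T hT hMT
    have hsub : (Finset.range (T ^ (n + 1))).filter D' ⊆ 
      ((Finset.range (T ^ (n + 1))).filter (fun x => ∃ i < n, 
        R * T ^ (i + 1) ≤ R * (x % T ^ (i + 1)) + T ^ (i + 1)) ∪ 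
       (Finset.range (T ^ (n + 1))).filter (fun x => ∃ a < M, ∃ b < M, a ≠ b ∧ 
        cnt T M n a x ≤ cnt T M n b x + 2 * k ∧ cnt T M n b x ≤ cnt T M n a x)) ∪ 
      (Finset.range (T ^ (n + 1))).filter (fun x => st.D (x + J x * w)) := by
      intro x hx
      rw [Finset.mem_filter] at hx
      obtain ⟨hx1, hx2⟩ := hx
      rw [Finset.mem_union, Finset.mem_union, Finset.mem_filter, Finset.mem_filter, Finset.mem_filter]
      rcases hx2 with h | h | h
      · left; left
        refine ⟨hx1, ?_⟩
        unfold CG at h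
        push Not at h
        exact h
      · left; right
        exact ⟨hx1, noWin hM h⟩
      · right; exact ⟨hx1, h⟩
    have hc := (Finset.card_le_card hsub).trans ((Finset.card_union_le _ _).trans 
      (Nat.add_le_add_right (Finset.card_union_le _ _) _))
    have hc' := (Nat.cast_le (α := ℝ)).2 hc
    push_cast at hc'
    have hd : st'.dens = (((Finset.range (T ^ (n + 1))).filter D').card : ℝ) / ((T ^ (n + 1) : ℕ) : ℝ) := by
      unfold Stg.dens
      congr!
    rw [hd]
    rw [div_le_iff₀ (by push_cast; exact hTr)]
    push_cast
    have h1' : (n / R : ℝ) * T ^ (n + 1) ≤ ε / 2 * T ^ (n + 1) := by gcongr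
    refine hc'.trans ?_
    rw [h3]
    linarith
  · change st.P < T ^ (n + 1)
    exact lt_of_lt_of_le hPltT (Nat.le_self_pow (by omega) _)
  · intro x hx
    have hTi : ∀ i, T ≤ T ^ (i + 1) := fun i => Nat.le_self_pow (by omega) _
    have hdig : ∀ i, x / T ^ (i + 1) = 0 := fun i => Nat.div_eq_of_lt (by have := hTi i; omega)
    have hc0 : cnt T M n 0 x = n := by
      unfold cnt
      rw [Finset.filter_true_of_mem, Finset.card_range]
      intro i _; rw [hdig]; simp
    have hcb : ∀ b, b ≠ 0 → cnt T M n b x = 0 := by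
      intro b hb
      unfold cnt
      rw [Finset.card_eq_zero, Finset.filter_eq_empty_iff]
      intro i _; rw [hdig]; simpa using hb.symm
    have hwin : IsWin T M n k x 0 := by
      refine ⟨hM, fun b _ hb => ?_⟩
      rw [hc0, hcb b hb]; omega
    have hJ : J x = 0 := Jw_eq hwin
    have hcg : CG T R n x := by
      intro i _
      have h1 := hTi i
      rw [Nat.mod_eq_of_lt (by omega)]
      have h2 : 2 * (R * x) < T := lt_of_lt_of_le (by gcongr) hTMR
      have h3 : 2 * T ^ (i + 1) ≤ R * T ^ (i + 1) := Nat.mul_le_mul_right _ (by omega)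
      omega
    constructor
    · change st.f (x + J x * w) + (J x : ZMod 2) = _
      rw [hJ]; simp
    · change (¬ CG T R n x ∨ ¬ (∃ a, IsWin T M n k x a) ∨ st.D (x + J x * w)) ↔ _
      rw [hJ]
      have : ∃ a, IsWin T M n k x a := ⟨0, hwin⟩
      simp [hcg, this]
  · intro β
    obtain ⟨c, hc1, hc2, hc3⟩ := hC (fun i => T ^ (i + 1)) β
    refine ⟨g + ∑ i ∈ Finset.range n, c i * T ^ (i + 1), Or.inr ⟨c, hc1, hk ▸ hc2, rfl⟩, fun l => ?_⟩
    obtain ⟨p, hp⟩ := hc3 l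
    refine ⟨p, ?_⟩
    convert hp using 3
    push_cast; ring


lemma circle_norm_le (x : ℝ) (p : ℤ) : ‖((x : ℝ) : AddCircle (1 : ℝ))‖ ≤ |x - p| := by
  rw [AddCircle.norm_eq]
  simpa using round_le x p

lemma bohr_dense (S : Set ℕ) (h : ∀ g d : ℕ, Hits S g d (1 / ((d : ℝ) + 1))) :
    BohrDense ((fun n : ℕ => (n : ℤ)) '' S) := by
  classical
  unfold BohrDense
  letI : TopologicalSpace ℤ := bohrTopology
  intro g
  rw [@mem_closure_iff_nhds ℤ bohrTopology]
  intro U hU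
  have hn : @nhds ℤ bohrTopology g = ⨅ φ : ℤ →+ AddCircle (1 : ℝ), Filter.comap φ (nhds (φ g)) := by
    unfold bohrTopology
    rw [nhds_iInf]
    simp only [nhds_induced]
  rw [hn] at hU
  have hb := Filter.HasBasis.iInf' (fun φ : ℤ →+ AddCircle (1 : ℝ) => 
    (Metric.nhds_basis_ball (x := φ g)).comap φ)
  obtain ⟨⟨I, ρ⟩, ⟨hI, hρ⟩, hsub⟩ := hb.mem_iff.1 hU
  simp only at hI hρ hsub
  set F := hI.toFinset with hF
  have hlift : ∀ φ : ℤ →+ AddCircle (1 : ℝ), ∃ b : ℝ, (b : AddCircle (1 : ℝ)) = φ 1 := fun φ => 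
    QuotientAddGroup.mk_surjective _
  choose b hb using hlift
  set d := F.card + ∑ φ ∈ F, ⌈2 / ρ φ⌉₊ with hd
  have hdρ : ∀ φ ∈ F, 2 / ((d : ℝ) + 1) < ρ φ := by
    intro φ hφ
    have hpos : 0 < ρ φ := hρ φ (by simpa [hF] using hφ)
    have h1 : ⌈2 / ρ φ⌉₊ ≤ d := by
      have := Finset.single_le_sum (f := fun φ => ⌈2 / ρ φ⌉₊) (fun _ _ => Nat.zero_le _) hφ
      omega
    have h2 : 2 / ρ φ ≤ d := (Nat.le_ceil _).trans (by exact_mod_cast h1)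
    rw [div_le_iff₀ hpos] at h2
    rw [div_lt_iff₀ (by positivity)]
    nlinarith
  obtain ⟨Q, hQ⟩ := dirichletB (ι := F) (δ := 1 / ((d + 1) * (|(g : ℝ)| + 1))) (by positivity)
  obtain ⟨q, hq0, -, p, hp⟩ := hQ (fun φ => b φ.1)
  obtain ⟨g', hg'⟩ : ∃ g' : ℕ, (g' : ℤ) = g + |g| * q := by
    have : 0 ≤ g + |g| * q := by
      have h1 : (1 : ℤ) ≤ q := by exact_mod_cast hq0
      nlinarith [abs_nonneg g, neg_abs_le g]
    exact ⟨(g + |g| * q).toNat, Int.toNat_of_nonneg this⟩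
  let e := F.equivFin
  let β : Fin d → ℝ := fun l => if h : l.1 < F.card then b (e.symm ⟨l.1, h⟩).1 else 0
  obtain ⟨s, hs, hsβ⟩ := h g' d β
  refine ⟨(s : ℤ), hsub ?_, ⟨s, hs, rfl⟩⟩
  simp only [Set.mem_iInter, Set.mem_preimage, Metric.mem_ball]
  intro φ hφ
  have hφF : φ ∈ F := by simpa [hF] using hφ
  refine lt_of_le_of_lt ?_ (hdρ φ hφF)
  obtain ⟨p1, hp1⟩ := hsβ ⟨(e ⟨φ, hφF⟩).1, by have := (e ⟨φ, hφF⟩).2; omega⟩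
  have hβ : β ⟨(e ⟨φ, hφF⟩).1, by have := (e ⟨φ, hφF⟩).2; omega⟩ = b φ := by
    simp [β]
  rw [hβ] at hp1
  have hp2 := hp ⟨φ, hφF⟩
  simp only at hp2
  have e1 : φ (s : ℤ) - φ g = ((((s : ℝ) - g) * b φ : ℝ) : AddCircle (1 : ℝ)) := by
    rw [← map_sub]
    have : φ ((s : ℤ) - g) = ((s : ℤ) - g) • φ 1 := by
      rw [← map_zsmul]; simp
    rw [this, ← hb, ← AddCircle.coe_zsmul]
    congr 1
    simp
  rw [dist_eq_norm, e1]
  refine (circle_norm_le _ (p1 + |g| * p ⟨φ, hφF⟩)).trans ?_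
  have hgr : (g' : ℝ) = g + |(g : ℝ)| * q := by exact_mod_cast hg'
  have e2 : ((s : ℝ) - g) * b φ - ((p1 + |g| * p ⟨φ, hφF⟩ : ℤ) : ℝ) = 
    (((s : ℝ) - g') * b φ - p1) + |(g : ℝ)| * (q * b φ - p ⟨φ, hφF⟩) := by
    rw [hgr]; push_cast; ring
  rw [e2]
  refine (abs_add_le _ _).trans ?_
  rw [abs_mul, abs_abs]
  have h3 : |(g : ℝ)| * |q * b φ - p ⟨φ, hφF⟩| ≤ 1 / ((d : ℝ) + 1) := by
    calc _ ≤ |(g : ℝ)| * (1 / ((d + 1) * (|(g : ℝ)| + 1))) := by gcongr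
      _ ≤ (|(g : ℝ)| + 1) * (1 / ((d + 1) * (|(g : ℝ)| + 1))) := by gcongr; linarith
      _ = _ := by field_simp
  have : 2 / ((d : ℝ) + 1) = 1 / ((d : ℝ) + 1) + 1 / ((d : ℝ) + 1) := by ring
  rw [this]
  exact add_le_add hp1 h3

lemma exists_seq {ε : ℝ} (hε : 0 < ε) : ∃ sq : ℕ → Stg, (∀ N, (sq N).dens ≤ ε) ∧ 
    ∀ N, (sq N).S ⊆ (sq (N + 1)).S ∧ (sq N).P < (sq (N + 1)).P ∧ 
      (∀ x < (sq N).P, (sq (N + 1)).f x = (sq N).f x ∧ ((sq (N + 1)).D x ↔ (sq N).D x)) ∧ 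
      Hits (sq (N + 1)).S N.unpair.1 N.unpair.2 (1 / ((N.unpair.2 : ℝ) + 1)) := by
  classical
  let st0 : Stg := 
    { P := 1, f := fun _ => 0, D := fun _ => False, S := ∅, B := 0
      hP := by norm_num
      hf := fun _ => rfl
      hD := fun _ => Iff.rfl
      hB := fun s hs => absurd hs (Set.notMem_empty s)
      flip := fun s hs => absurd hs (Set.notMem_empty s) }
  have hstep : ∀ (N : ℕ) (st : Stg), ∃ st' : Stg, st.S ⊆ st'.S ∧ 
      st'.dens ≤ st.dens + ε / 2 ^ (N + 1) ∧ st.P < st'.P ∧ 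
      (∀ x < st.P, st'.f x = st.f x ∧ (st'.D x ↔ st.D x)) ∧ 
      Hits st'.S N.unpair.1 N.unpair.2 (1 / ((N.unpair.2 : ℝ) + 1)) := fun N st => 
    step st _ _ (by positivity) (by positivity)
  choose nx hnx using hstep
  let sq : ℕ → Stg := fun N => Nat.rec st0 (fun N st => nx N st) N
  have hsq : ∀ N, sq (N + 1) = nx N (sq N) := fun N => rfl
  refine ⟨sq, ?_, fun N => ?_⟩
  · have : ∀ N, (sq N).dens ≤ ε * (1 - 1 / 2 ^ N) := by
      intro N
      induction N with
      | zero => simp [sq, Stg.dens, st0]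
      | succ N ih =>
        have h := (hnx N (sq N)).2.1
        rw [← hsq] at h
        refine h.trans ?_
        have : ε * (1 - 1 / 2 ^ (N + 1)) = ε * (1 - 1 / 2 ^ N) + ε / 2 ^ (N + 1) := by
          rw [pow_succ]; field_simp; ring
        rw [this]; gcongr
    intro N
    refine (this N).trans ?_
    have : (0 : ℝ) ≤ 1 / 2 ^ N := by positivity
    nlinarith
  · rw [hsq]
    obtain ⟨h1, h2, h3, h4, h5⟩ := hnx N (sq N)
    exact ⟨h1, h3, h4, h5⟩

lemma density_lower (A : Set ℤ) (c : ℝ) (h : ∃ᶠ n : ℕ in atTop, 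
    c * n ≤ (Nat.card ↥(A ∩ Set.Ioc (-1 : ℤ) (-1 + n)) : ℝ)) : c ≤ upperBanachDensity A := by
  have hle : ∀ (n : ℕ) (k : ℤ), (Nat.card ↥(A ∩ Set.Ioc k (k + n)) : ℝ) / n ≤ 1 := by
    intro n k
    apply div_le_one_of_le₀ _ (by positivity)
    have h1 : Nat.card ↥(A ∩ Set.Ioc k (k + n)) ≤ Nat.card (Set.Ioc k (k + n)) := 
      Nat.card_mono (Set.finite_Ioc _ _) Set.inter_subset_right
    have h2 : Nat.card (Set.Ioc k (k + n)) = n := by simp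
    rw [h2] at h1
    exact_mod_cast h1
  have hnn : ∀ n : ℕ, 0 ≤ ⨆ k : ℤ, (Nat.card ↥(A ∩ Set.Ioc k (k + n)) : ℝ) / n := fun n => 
    Real.iSup_nonneg fun k => by positivity
  unfold upperBanachDensity
  refine Filter.le_limsup_of_frequently_le ?_ ?_
  · refine (h.and_eventually (eventually_gt_atTop 0)).mono ?_
    rintro n ⟨hn, hn0⟩
    have hn0' : (0 : ℝ) < n := by exact_mod_cast hn0
    refine le_trans ?_ (le_ciSup (f := fun k : ℤ => (Nat.card ↥(A ∩ Set.Ioc k (k + n)) : ℝ) / n) 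
      ⟨1, by rintro _ ⟨k, rfl⟩; exact hle n k⟩ (-1))
    rw [le_div_iff₀ hn0']
    exact hn
  · exact ⟨1, by
      rw [eventually_map]
      exact Eventually.of_forall fun n => ciSup_le fun k => hle n k⟩

theorem stmt0 :
    ∀ ε : ℝ, 0 < ε →
      ∃ S A : Set ℤ, BohrDense S ∧ 1 / 2 - ε < upperBanachDensity A ∧
        (A - A) ∩ S = ∅ := by
  classical
  intro ε hε
  obtain ⟨sq, hdens, hsq⟩ := exists_seq hε
  have hmonoP : StrictMono (fun N => (sq N).P) := strictMono_nat_of_lt_succ fun N => (hsq N).2.1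
  have hmonoS : Monotone (fun N => (sq N).S) := monotone_nat_of_le_succ fun N => (hsq N).1
  have hNP : ∀ N, N ≤ (sq N).P := fun N => hmonoP.id_le N
  have hagree : ∀ N N', N ≤ N' → ∀ x < (sq N).P, (sq N').f x = (sq N).f x ∧ 
      ((sq N').D x ↔ (sq N).D x) := by
    intro N N' h
    induction N', h using Nat.le_induction with
    | base => intro x _; exact ⟨rfl, Iff.rfl⟩
    | succ N' hN ih =>
      intro x hx
      have h1 := ih x hx
      have h2 := (hsq N').2.2.1 x (lt_of_lt_of_le hx (hmonoP.monotone hN))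
      exact ⟨h2.1.trans h1.1, h2.2.trans h1.2⟩
  let f : ℕ → ZMod 2 := fun x => (sq (x + 1)).f x
  let D : ℕ → Prop := fun x => (sq (x + 1)).D x
  have hfD : ∀ N x, x < (sq N).P → (sq N).f x = f x ∧ ((sq N).D x ↔ D x) := by
    intro N x hx
    have hx' : x < (sq (x + 1)).P := by have := hNP (x + 1); omega
    rcases le_total N (x + 1) with h | h
    · have := hagree N (x + 1) h x hx
      exact ⟨this.1.symm, this.2.symm⟩
    · exact hagree (x + 1) N h x hx'
  let A : ZMod 2 → Set ℤ := fun v => (fun n : ℕ => (n : ℤ)) '' {x | f x = v ∧ ¬ D x}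
  let S : Set ℕ := ⋃ N, (sq N).S
  have hcount : ∀ N, ∃ v : ZMod 2, (1 / 2 - ε / 2) * ((sq N).P : ℝ) ≤ 
      (Nat.card ↥(A v ∩ Set.Ioc (-1 : ℤ) (-1 + (sq N).P)) : ℝ) := by
    intro N
    have hPpos : (0 : ℝ) < (sq N).P := by exact_mod_cast (sq N).hP
    have hcard : ∀ v, ((Finset.range (sq N).P).filter (fun x => f x = v ∧ ¬ D x)).card ≤ 
        Nat.card ↥(A v ∩ Set.Ioc (-1 : ℤ) (-1 + (sq N).P)) := by
      intro v
      have hsub : ((((Finset.range (sq N).P).filter (fun x => f x = v ∧ ¬ D x)).image 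
          (fun n : ℕ => (n : ℤ)) : Finset ℤ) : Set ℤ) ⊆ A v ∩ Set.Ioc (-1 : ℤ) (-1 + (sq N).P) := by
        intro y hy
        simp only [Finset.coe_image, Finset.coe_filter, Finset.mem_range, Set.mem_image, 
          Set.mem_setOf_eq] at hy
        obtain ⟨x, ⟨hx1, hx2⟩, rfl⟩ := hy
        refine ⟨⟨x, hx2, rfl⟩, ?_⟩
        rw [Set.mem_Ioc]; omega
      have h1 := Nat.card_mono ((Set.finite_Ioc _ _).subset Set.inter_subset_right) hsub
      rw [Nat.card_coe_set_eq, Set.ncard_coe_finset, 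
        Finset.card_image_of_injective _ Nat.cast_injective] at h1
      exact h1
    have hsum : (sq N).P ≤ ((Finset.range (sq N).P).filter (fun x => f x = 0 ∧ ¬ D x)).card + 
        ((Finset.range (sq N).P).filter (fun x => f x = 1 ∧ ¬ D x)).card + 
        ((Finset.range (sq N).P).filter (sq N).D).card := by
      refine le_trans ?_ ((Nat.add_le_add_right (Finset.card_union_le _ _) _))
      refine le_trans ?_ (Finset.card_union_le _ _)
      conv_lhs => rw [← Finset.card_range (sq N).P]
      refine Finset.card_le_card fun x hx => ?_
      have hxP := Finset.mem_range.1 hx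
      simp only [Finset.mem_union, Finset.mem_filter, hx, true_and]
      by_cases hD : D x
      · right; exact (hfD N x hxP).2.2 hD
      · left
        have : ∀ z : ZMod 2, z = 0 ∨ z = 1 := by decide
        rcases this (f x) with h | h
        · left; exact ⟨h, hD⟩
        · right; exact ⟨h, hD⟩
    have hD : (((Finset.range (sq N).P).filter (sq N).D).card : ℝ) ≤ ε * (sq N).P := by
      have := hdens N
      unfold Stg.dens at this
      rw [div_le_iff₀ hPpos] at this
      convert this
    have hsum' := (Nat.cast_le (α := ℝ)).2 hsum
    push_cast at hsum'
    have c0 := (Nat.cast_le (α := ℝ)).2 (hcard 0)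
    have c1 := (Nat.cast_le (α := ℝ)).2 (hcard 1)
    by_contra hcon
    push Not at hcon
    have k0 := hcon 0
    have k1 := hcon 1
    nlinarith
  choose v hv using hcount
  obtain ⟨v0, hv0⟩ : ∃ v0, ∃ᶠ N in atTop, v N = v0 := by
    by_contra hcon
    push Not at hcon
    have h0 := hcon 0
    have h1 := hcon 1
    obtain ⟨N, hN0, hN1⟩ := (h0.and h1).exists
    have : ∀ z : ZMod 2, z = 0 ∨ z = 1 := by decide
    rcases this (v N) with h | h
    · exact hN0 h
    · exact hN1 h
  refine ⟨(fun n : ℕ => (n : ℤ)) '' S, A v0, ?_, ?_, ?_⟩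
  · apply bohr_dense
    intro g d β
    have h := (hsq (Nat.pair g d)).2.2.2
    simp only [Nat.unpair_pair] at h
    obtain ⟨s, hs, h2⟩ := h β
    exact ⟨s, Set.mem_iUnion.2 ⟨_, hs⟩, h2⟩
  · refine lt_of_lt_of_le (b := 1 / 2 - ε / 2) (by linarith) (density_lower _ _ ?_)
    have ht : Tendsto (fun N => (sq N).P) atTop atTop := hmonoP.tendsto_atTop
    refine ht.frequently (hv0.mono fun N hN => ?_)
    have := hv N
    rw [hN] at this
    exact this
  · rw [Set.eq_empty_iff_forall_notMem]
    rintro z ⟨hz, s, hs, rfl⟩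
    obtain ⟨a, ⟨x, ⟨hx1, hx2⟩, rfl⟩, b, ⟨y, ⟨hy1, hy2⟩, rfl⟩, hxy⟩ := Set.mem_sub.1 hz
    have hxs : x = y + s := by
      simp only at hxy; omega
    subst hxs
    obtain ⟨N0, hN0⟩ := Set.mem_iUnion.1 hs
    set N := N0 + (y + s + 1) with hN
    have hsN : s ∈ (sq N).S := hmonoS (by omega : N0 ≤ N) hN0
    have hP := hNP N
    have a1 := hfD N (y + s) (by omega)
    have a2 := hfD N y (by omega)
    have := (sq N).flip s hsN y (fun h => hy2 (a2.2.1 h)) (fun h => hx2 (a1.2.1 h))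
    rw [a1.1, a2.1, hx1, hy1] at this
    have hne : ∀ z : ZMod 2, z ≠ z + 1 := by decide
    exact hne _ this
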